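/- arXiv:1705.09059 — 5 statements merged into one kernel-verified Lean document; each statement's English description precedes it below -/
import Mathlib

section
/- Let K ≥ 1 and let (a_k)_{k=0..K}, (b_k)_{k=0..K} be sequences of nonnegative reals with b_0 = 0, and (f_k)_{k=0..K} a sequence of reals. Suppose there are positive constants a, c, d and a constant b > 0 with b ≠ 1 such that for all k = 0,…,K−1: f_{k+1} ≤ f_k − c·a_k + d·b_k and b_{k+1} ≤ b·b_k + a·a_k. Then f_K ≤ f_0 − Σ_{k=0}^{K−1} Δ_k·a_k, where Δ_k = c − a·d·(b^{K−1−k} − 1)/(b − 1). -/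
theorem potential_le_sub_sum {K : ℕ} {a b f g : ℕ → ℝ} {A B C D : ℝ} (hD : 0 ≤ D)
    (hb0 : b 0 = 0) (hg : ∀ m, 0 ≤ g m) (hgs : ∀ m, g (m + 1) = B * g m + 1)
    (h1 : ∀ k, k < K → f (k + 1) ≤ f k - C * a k + D * b k)
    (h2 : ∀ k, k < K → b (k + 1) ≤ B * b k + A * a k) (n : ℕ) (hn : n ≤ K) :
    f n + D * g (K - n) * b n ≤
      f 0 - ∑ k ∈ Finset.range n, (C - A * D * g (K - 1 - k)) * a k := by
  induction n with
  | zero => simp [hb0]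
  | succ n ih =>
    have hprev := ih (by omega)
    have hstep := mul_le_mul_of_nonneg_left (h2 n hn) (mul_nonneg hD (hg (K - 1 - n)))
    have hf := h1 n hn
    rw [show K - n = K - 1 - n + 1 by omega, hgs] at hprev
    rw [Finset.sum_range_succ, show K - (n + 1) = K - 1 - n by omega]
    linarith

/-- recursion lemma (Lemma on sequences). -/
theorem stmt_0 (K : ℕ) (hK : 1 ≤ K) (a b f : ℕ → ℝ)
    (ha : ∀ k, k ≤ K → 0 ≤ a k) (hb : ∀ k, k ≤ K → 0 ≤ b k) (hb0 : b 0 = 0)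
    (A B C D : ℝ) (hA : 0 < A) (hB : 0 < B) (hBne : B ≠ 1) (hC : 0 < C) (hD : 0 < D)
    (h1 : ∀ k, k < K → f (k + 1) ≤ f k - C * a k + D * b k)
    (h2 : ∀ k, k < K → b (k + 1) ≤ B * b k + A * a k) :
    f K ≤ f 0 - ∑ k ∈ Finset.range K, (C - A * D * ((B ^ (K - 1 - k) - 1) / (B - 1))) * a k := by
  have hmain := potential_le_sub_sum (g := fun m => ∑ i ∈ Finset.range m, B ^ i) hD.le hb0
    (fun m => Finset.sum_nonneg fun i _ => pow_nonneg hB.le i) (fun m => geom_sum_succ) h1 h2 K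
    le_rfl
  simpa [geom_sum_eq hBne] using hmain
end

section
/- Let f : ℝ^{d×r} → ℝ be differentiable with gradient ∇f that is L-Lipschitz (with respect to the Frobenius norm), and let R : ℝ → ℝ^{d×r} be a curve, differentiable at 0, with R(0) = X. Assume there exist constants L₁ ≥ 1, L₂ > 0, C > 0 such that for all t ≥ 0: ‖R(t) − R(0)‖_F ≤ L₁·t·‖R'(0)‖_F, ‖R(t) − R(0) − t·R'(0)‖_F ≤ L₂·t²·‖R'(0)‖_F², and ‖∇f(X)‖_F ≤ C. Then for all t ≥ 0: f(R(t)) ≤ f(X) + t·⟨∇f(X), R'(0)⟩ + (L̂/2)·t²·‖R'(0)‖_F², where L̂ = 2·L₂·C + L₁²·L. -/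
open Matrix

attribute [local instance] Matrix.frobeniusNormedAddCommGroup Matrix.frobeniusNormedSpace

/-- Frobenius norm of a real matrix. -/
noncomputable def frobNorm {d r : ℕ} (A : Matrix (Fin d) (Fin r) ℝ) : ℝ :=
  Real.sqrt (∑ i, ∑ j, (A i j) ^ 2)

theorem frobNorm_nonneg {d r : ℕ} (A : Matrix (Fin d) (Fin r) ℝ) : 0 ≤ frobNorm A :=
  Real.sqrt_nonneg _

theorem frobNorm_smul_of_nonneg {d r : ℕ} {s : ℝ} (hs : 0 ≤ s) (A : Matrix (Fin d) (Fin r) ℝ) :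
    frobNorm (s • A) = s * frobNorm A := by
  simp only [frobNorm, Matrix.smul_apply, smul_eq_mul, mul_pow, ← Finset.mul_sum]
  rw [Real.sqrt_mul (sq_nonneg s), Real.sqrt_sq hs]

/-- Cauchy–Schwarz inequality for the Frobenius inner product. -/
theorem trace_transpose_mul_le_frobNorm_mul {d r : ℕ} (A B : Matrix (Fin d) (Fin r) ℝ) :
    Matrix.trace (Aᵀ * B) ≤ frobNorm A * frobNorm B := by
  have htrace : Matrix.trace (Aᵀ * B) = ∑ p : Fin d × Fin r, A p.1 p.2 * B p.1 p.2 := by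
    rw [Fintype.sum_prod_type, Finset.sum_comm]
    simp [Matrix.trace, Matrix.mul_apply]
  have h := Real.sum_mul_le_sqrt_mul_sqrt Finset.univ
    (fun p : Fin d × Fin r => A p.1 p.2) (fun p => B p.1 p.2)
  rw [htrace]
  simpa only [frobNorm, Fintype.sum_prod_type] using h

/-- Descent lemma: the quadratic upper bound for a function with `L`-Lipschitz gradient. -/
theorem le_add_trace_add_of_lipschitz_gradient {d r : ℕ}
    {f : Matrix (Fin d) (Fin r) ℝ → ℝ}
    {g : Matrix (Fin d) (Fin r) ℝ → Matrix (Fin d) (Fin r) ℝ} {L : ℝ}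
    (hdiff : Differentiable ℝ f)
    (hgrad : ∀ Y H, fderiv ℝ f Y H = Matrix.trace ((g Y)ᵀ * H))
    (hLip : ∀ Y₁ Y₂, frobNorm (g Y₁ - g Y₂) ≤ L * frobNorm (Y₁ - Y₂))
    (X V : Matrix (Fin d) (Fin r) ℝ) :
    f (X + V) ≤ f X + Matrix.trace ((g X)ᵀ * V) + L / 2 * frobNorm V ^ 2 := by
  set φ : ℝ → ℝ := fun s =>
    f (X + s • V) - s * Matrix.trace ((g X)ᵀ * V) - L / 2 * frobNorm V ^ 2 * s ^ 2 with hφ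
  have hderiv (s : ℝ) : HasDerivAt φ
      (Matrix.trace ((g (X + s • V) - g X)ᵀ * V) - L * s * frobNorm V ^ 2) s := by
    have hline : HasDerivAt (fun s : ℝ => X + s • V) V s :=
      (((hasDerivAt_id s).smul_const V).const_add X).congr_deriv (one_smul ℝ V)
    have hf := ((hdiff (X + s • V)).hasFDerivAt.comp_hasDerivAt s hline).congr_deriv
      (hgrad (X + s • V) V)
    have h := (hf.sub ((hasDerivAt_id s).mul_const (Matrix.trace ((g X)ᵀ * V)))).sub
      (((hasDerivAt_id s).pow 2).const_mul (L / 2 * frobNorm V ^ 2))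
    refine h.congr_deriv ?_
    rw [Matrix.transpose_sub, Matrix.sub_mul, Matrix.trace_sub]
    simp only [id_eq]
    ring
  have hanti : AntitoneOn φ (Set.Ici 0) := by
    refine antitoneOn_of_deriv_nonpos (convex_Ici 0)
      (fun s _ => (hderiv s).continuousAt.continuousWithinAt)
      (fun s _ => (hderiv s).differentiableAt.differentiableWithinAt) fun s hs => ?_
    rw [interior_Ici, Set.mem_Ioi] at hs
    rw [(hderiv s).deriv, sub_nonpos]
    have hbound := hLip (X + s • V) X
    rw [add_sub_cancel_left, frobNorm_smul_of_nonneg hs.le] at hbound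
    calc Matrix.trace ((g (X + s • V) - g X)ᵀ * V)
        ≤ frobNorm (g (X + s • V) - g X) * frobNorm V := trace_transpose_mul_le_frobNorm_mul _ _
      _ ≤ L * (s * frobNorm V) * frobNorm V :=
        mul_le_mul_of_nonneg_right hbound (frobNorm_nonneg V)
      _ = L * s * frobNorm V ^ 2 := by ring
  have h := hanti (Set.mem_Ici.2 le_rfl) (Set.mem_Ici.2 zero_le_one) zero_le_one
  simp only [hφ, one_smul, zero_smul, add_zero] at h
  linarith

/-- sufficient decrease property along a retraction-like curve. -/
theorem stmt_2 {d r : ℕ}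
    (f : Matrix (Fin d) (Fin r) ℝ → ℝ)
    (g : Matrix (Fin d) (Fin r) ℝ → Matrix (Fin d) (Fin r) ℝ)
    (L : ℝ) (hL : 0 < L)
    (hdiff : Differentiable ℝ f)
    (hgrad : ∀ Y H, fderiv ℝ f Y H = Matrix.trace ((g Y)ᵀ * H))
    (hLip : ∀ Y₁ Y₂, frobNorm (g Y₁ - g Y₂) ≤ L * frobNorm (Y₁ - Y₂))
    (R : ℝ → Matrix (Fin d) (Fin r) ℝ)
    (X E : Matrix (Fin d) (Fin r) ℝ)
    (hR0 : R 0 = X) (hR' : HasDerivAt R E 0)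
    (L₁ L₂ C : ℝ) (hL₁ : 1 ≤ L₁) (hL₂ : 0 < L₂) (hC : 0 < C)
    (h1 : ∀ t : ℝ, 0 ≤ t → frobNorm (R t - R 0) ≤ L₁ * t * frobNorm E)
    (h2 : ∀ t : ℝ, 0 ≤ t → frobNorm (R t - R 0 - t • E) ≤ L₂ * t ^ 2 * frobNorm E ^ 2)
    (hgX : frobNorm (g X) ≤ C) :
    ∀ t : ℝ, 0 ≤ t →
      f (R t) ≤ f X + t * Matrix.trace ((g X)ᵀ * E)
        + ((2 * L₂ * C + L₁ ^ 2 * L) / 2) * t ^ 2 * frobNorm E ^ 2 := by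
  intro t ht
  subst hR0
  have hdescent := le_add_trace_add_of_lipschitz_gradient hdiff hgrad hLip (R 0) (R t - R 0)
  rw [add_sub_cancel] at hdescent
  have hsplit : Matrix.trace ((g (R 0))ᵀ * (R t - R 0))
      = t * Matrix.trace ((g (R 0))ᵀ * E)
        + Matrix.trace ((g (R 0))ᵀ * (R t - R 0 - t • E)) := by
    rw [Matrix.mul_sub _ (R t - R 0), Matrix.trace_sub, Matrix.mul_smul, Matrix.trace_smul,
      smul_eq_mul]
    ring
  have hremainder : Matrix.trace ((g (R 0))ᵀ * (R t - R 0 - t • E))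
      ≤ C * (L₂ * t ^ 2 * frobNorm E ^ 2) :=
    (trace_transpose_mul_le_frobNorm_mul _ _).trans
      (mul_le_mul hgX (h2 t ht) (frobNorm_nonneg _) hC.le)
  have hquadratic : L / 2 * frobNorm (R t - R 0) ^ 2 ≤ L / 2 * (L₁ * t * frobNorm E) ^ 2 :=
    mul_le_mul_of_nonneg_left (pow_le_pow_left₀ (frobNorm_nonneg _) (h1 t ht) 2) (by positivity)
  linarith
end

section
/- Let ρ > 0, let X ∈ ℝ^{d×r} satisfy XᵀX = I_r, and let Y ∈ ℝ^{d×r} be arbitrary. Then for every E ∈ ℝ^{d×r} with XᵀE + EᵀX = 0, one has tr(D_ρ(X,Y)ᵀ · P_{ρ,X} · E) = tr(Yᵀ E), where P_{ρ,X} = I_d − (1 − 1/(4ρ))·XXᵀ. (That is, D_ρ(X,Y) is the Riemannian gradient representative of Y with respect to the inner product ⟨E₁,E₂⟩_X = tr(E₁ᵀ P_{ρ,X} E₂) on the tangent space.) -/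
open Matrix

/-- The operator `D_ρ(X,Y) = (I - XXᵀ)Y + 4ρ·X·skew(XᵀY)` where `skew(A) = (A - Aᵀ)/2`. -/
noncomputable def Drho {d r : ℕ} (ρ : ℝ) (X Y : Matrix (Fin d) (Fin r) ℝ) :
    Matrix (Fin d) (Fin r) ℝ :=
  (1 - X * Xᵀ) * Y + (4 * ρ) • (X * ((1 / 2 : ℝ) • (Xᵀ * Y - Yᵀ * X)))

/-- `D_ρ(X,Y)` is the Riemannian-gradient representative of `Y` w.r.t. the
inner product `⟨E₁,E₂⟩_X = tr(E₁ᵀ P_{ρ,X} E₂)` on the tangent space. -/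
theorem stmt_5 {d r : ℕ} (ρ : ℝ) (hρ : 0 < ρ)
    (X Y : Matrix (Fin d) (Fin r) ℝ) (hX : Xᵀ * X = 1) :
    ∀ E : Matrix (Fin d) (Fin r) ℝ, Xᵀ * E + Eᵀ * X = 0 →
      Matrix.trace ((Drho ρ X Y)ᵀ * ((1 - (1 - 1 / (4 * ρ)) • (X * Xᵀ)) * E))
        = Matrix.trace (Yᵀ * E) := by
  intro E hE
  have hE_skew : Eᵀ * X = -(Xᵀ * E) := (neg_eq_of_add_eq_zero_right hE).symm
  have h_metric : Xᵀ * ((1 - (1 - 1 / (4 * ρ)) • (X * Xᵀ)) * E) = (1 / (4 * ρ)) • (Xᵀ * E) := by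
    have h : Xᵀ * (X * (Xᵀ * E)) = Xᵀ * E := by
      rw [← Matrix.mul_assoc, hX, Matrix.one_mul]
    rw [Matrix.sub_mul, Matrix.one_mul, Matrix.smul_mul, Matrix.mul_assoc, Matrix.mul_sub,
      Matrix.mul_smul, h]
    module
  have h_normal : (1 - X * Xᵀ) * ((1 - (1 - 1 / (4 * ρ)) • (X * Xᵀ)) * E)
      = E - X * (Xᵀ * E) := by
    rw [Matrix.sub_mul 1 (X * Xᵀ), Matrix.one_mul, Matrix.mul_assoc X Xᵀ, h_metric,
      Matrix.sub_mul, Matrix.one_mul, Matrix.smul_mul, Matrix.mul_assoc, Matrix.mul_smul]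
    module
  have h_transpose : (Drho ρ X Y)ᵀ
      = Yᵀ * (1 - X * Xᵀ) + (2 * ρ) • ((Yᵀ * X - Xᵀ * Y) * Xᵀ) := by
    simp only [Drho, transpose_add, transpose_sub, transpose_mul, transpose_smul,
      transpose_transpose, transpose_one, Matrix.mul_smul, smul_smul]
    congr 2
    ring
  have h_trace : trace (Xᵀ * Y * (Xᵀ * E)) = -trace (Yᵀ * X * (Xᵀ * E)) := by
    rw [← trace_transpose, transpose_mul, transpose_mul, transpose_mul, transpose_transpose,
      hE_skew, Matrix.neg_mul, trace_neg, trace_mul_comm]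
  rw [h_transpose, Matrix.add_mul, Matrix.mul_assoc Yᵀ, h_normal, Matrix.smul_mul,
    Matrix.mul_assoc _ Xᵀ, h_metric, Matrix.mul_smul, Matrix.sub_mul, Matrix.mul_sub,
    ← Matrix.mul_assoc Yᵀ X]
  simp only [trace_add, trace_sub, trace_smul, smul_eq_mul, h_trace]
  field_simp
  ring
end

section
/- Let ρ > 0 and let X ∈ ℝ^{d×r} satisfy XᵀX = I_r. Then for all Y₁, Y₂ ∈ ℝ^{d×r}: ‖D_ρ(X,Y₁) − D_ρ(X,Y₂)‖_F ≤ (1/ν)·‖Y₁ − Y₂‖_F, where ν = min(1, 1/(4ρ)). -/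
open Matrix

/-- The squared Frobenius norm is `tr(AᵀA)`. -/
theorem trace_transpose_mul_self_eq_sum_sq {m n : ℕ} (A : Matrix (Fin m) (Fin n) ℝ) :
    (Aᵀ * A).trace = ∑ i, ∑ j, (A i j) ^ 2 := by
  rw [Finset.sum_comm]
  simp [Matrix.trace, Matrix.mul_apply, sq]

theorem trace_transpose_mul_self_nonneg {m n : ℕ} (A : Matrix (Fin m) (Fin n) ℝ) :
    0 ≤ (Aᵀ * A).trace := by
  rw [trace_transpose_mul_self_eq_sum_sq]
  positivity

/-- Pythagoras for the sum of a matrix `P` orthogonal to the columns of `X` and a matrix `X * B`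
in the column space of `X`. -/
theorem trace_transpose_mul_self_add_mul {d r k : ℕ} {X : Matrix (Fin d) (Fin r) ℝ}
    (hX : Xᵀ * X = 1) {P : Matrix (Fin d) (Fin k) ℝ} (hP : Xᵀ * P = 0)
    (B : Matrix (Fin r) (Fin k) ℝ) :
    ((P + X * B)ᵀ * (P + X * B)).trace = (Pᵀ * P).trace + (Bᵀ * B).trace := by
  have hP' : Pᵀ * X = 0 := by simpa using congrArg Matrix.transpose hP
  have h₁ : Pᵀ * (X * B) = 0 := by rw [← Matrix.mul_assoc, hP', Matrix.zero_mul]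
  have h₂ : Bᵀ * Xᵀ * P = 0 := by rw [Matrix.mul_assoc, hP, Matrix.mul_zero]
  have h₃ : Bᵀ * Xᵀ * (X * B) = Bᵀ * B := by
    rw [Matrix.mul_assoc, ← Matrix.mul_assoc Xᵀ, hX, Matrix.one_mul]
  simp [Matrix.add_mul, Matrix.mul_add, h₁, h₂, h₃]

/-- Taking the skew-symmetric part does not increase the Frobenius norm. -/
theorem trace_transpose_mul_self_skew_le {n : ℕ} (A : Matrix (Fin n) (Fin n) ℝ) :
    (((1 / 2 : ℝ) • (A - Aᵀ))ᵀ * ((1 / 2 : ℝ) • (A - Aᵀ))).trace ≤ (Aᵀ * A).trace := by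
  have h := trace_transpose_mul_self_nonneg (A + Aᵀ)
  have hc : (A * Aᵀ).trace = (Aᵀ * A).trace := Matrix.trace_mul_comm _ _
  simp only [Matrix.transpose_add, Matrix.transpose_sub, Matrix.transpose_smul,
    Matrix.transpose_transpose, Matrix.add_mul, Matrix.mul_add, Matrix.sub_mul, Matrix.mul_sub,
    Matrix.smul_mul, Matrix.mul_smul, Matrix.trace_add, Matrix.trace_sub, Matrix.trace_smul,
    smul_eq_mul] at h ⊢
  linarith

theorem Drho_sub {d r : ℕ} (ρ : ℝ) (X Y₁ Y₂ : Matrix (Fin d) (Fin r) ℝ) :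
    Drho ρ X Y₁ - Drho ρ X Y₂ = Drho ρ X (Y₁ - Y₂) := by
  simp only [Drho, Matrix.transpose_sub, Matrix.mul_sub, Matrix.sub_mul, Matrix.mul_smul,
    smul_sub]
  abel

theorem frobNorm_Drho_le {d r : ℕ} {ρ L : ℝ} (hρ : 0 ≤ ρ) (hL₁ : 1 ≤ L) (hLρ : 4 * ρ ≤ L)
    {X : Matrix (Fin d) (Fin r) ℝ} (hX : Xᵀ * X = 1) (Y : Matrix (Fin d) (Fin r) ℝ) :
    frobNorm (Drho ρ X Y) ≤ L * frobNorm Y := by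
  have hP : Xᵀ * ((1 - X * Xᵀ) * Y) = 0 := by
    rw [← Matrix.mul_assoc, Matrix.mul_sub, ← Matrix.mul_assoc Xᵀ, hX]
    simp
  have hY : (Yᵀ * Y).trace = (((1 - X * Xᵀ) * Y)ᵀ * ((1 - X * Xᵀ) * Y)).trace
      + ((Xᵀ * Y)ᵀ * (Xᵀ * Y)).trace := by
    rw [← trace_transpose_mul_self_add_mul hX hP]
    simp [Matrix.sub_mul, Matrix.mul_assoc]
  have hD : ((Drho ρ X Y)ᵀ * Drho ρ X Y).trace
      = (((1 - X * Xᵀ) * Y)ᵀ * ((1 - X * Xᵀ) * Y)).trace + (4 * ρ) ^ 2 *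
        (((1 / 2 : ℝ) • (Xᵀ * Y - (Xᵀ * Y)ᵀ))ᵀ * ((1 / 2 : ℝ) • (Xᵀ * Y - (Xᵀ * Y)ᵀ))).trace := by
    rw [Drho, ← Matrix.mul_smul, trace_transpose_mul_self_add_mul hX hP, Matrix.transpose_mul Xᵀ,
      Matrix.transpose_transpose, Matrix.transpose_smul (4 * ρ), Matrix.smul_mul (4 * ρ),
      Matrix.mul_smul _ (4 * ρ), Matrix.trace_smul, Matrix.trace_smul, smul_eq_mul, smul_eq_mul]
    ring
  have hS := trace_transpose_mul_self_skew_le (Xᵀ * Y)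
  have hP₀ := trace_transpose_mul_self_nonneg ((1 - X * Xᵀ) * Y)
  have hA₀ := trace_transpose_mul_self_nonneg (Xᵀ * Y)
  have hL₀ : 0 ≤ L := by linarith
  have hsq₁ : 1 ≤ L ^ 2 := one_le_pow₀ hL₁
  have hsqρ : (4 * ρ) ^ 2 ≤ L ^ 2 := by gcongr
  rw [frobNorm, frobNorm, ← trace_transpose_mul_self_eq_sum_sq,
    ← trace_transpose_mul_self_eq_sum_sq]
  refine Real.sqrt_le_iff.mpr ⟨by positivity, ?_⟩
  rw [mul_pow, Real.sq_sqrt (trace_transpose_mul_self_nonneg Y), hD, hY, mul_add]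
  refine add_le_add (le_mul_of_one_le_left hP₀ hsq₁) ?_
  calc _ ≤ (4 * ρ) ^ 2 * ((Xᵀ * Y)ᵀ * (Xᵀ * Y)).trace := by gcongr
    _ ≤ _ := by gcongr

/-- Lipschitz bound for `Y ↦ D_ρ(X,Y)` with constant `1/ν`, `ν = min(1, 1/(4ρ))`. -/
theorem stmt_6 {d r : ℕ} (ρ : ℝ) (hρ : 0 < ρ)
    (X : Matrix (Fin d) (Fin r) ℝ) (hX : Xᵀ * X = 1) :
    ∀ Y₁ Y₂ : Matrix (Fin d) (Fin r) ℝ,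
      frobNorm (Drho ρ X Y₁ - Drho ρ X Y₂)
        ≤ (1 / min 1 (1 / (4 * ρ))) * frobNorm (Y₁ - Y₂) := by
  intro Y₁ Y₂
  have hν : 0 < min 1 (1 / (4 * ρ)) := by positivity
  rw [Drho_sub]
  refine frobNorm_Drho_le hρ.le ?_ ?_ hX _
  · rw [le_div_iff₀ hν, one_mul]
    exact min_le_left _ _
  · rw [le_div_iff₀ hν, ← le_div_iff₀' (by positivity)]
    exact min_le_right _ _
end

section
/- Let X ∈ ℝ^{d×r} satisfy XᵀX = I_r and let E ∈ ℝ^{d×r} satisfy XᵀE + EᵀX = 0. For t ≥ 0, the matrix I_r + t²·EᵀE is positive definite; let H(t) denote its positive semidefinite square root and define the polar-decomposition retraction Y(t) = (X + tE)·H(t)⁻¹. Then for all t ≥ 0: ‖Y(t) − X‖_F ≤ t·‖E‖_F. -/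
open Matrix

theorem frobNorm_eq_sqrt_trace {d r : ℕ} (A : Matrix (Fin d) (Fin r) ℝ) :
    frobNorm A = Real.sqrt (Aᵀ * A).trace := by
  unfold frobNorm
  rw [Finset.sum_comm]
  simp [Matrix.trace, Matrix.mul_apply, pow_two]

/-- The trace of a product of a skew-symmetric and a symmetric real matrix vanishes. -/
theorem trace_mul_eq_zero_of_skew_of_symm {r : ℕ} {W K : Matrix (Fin r) (Fin r) ℝ}
    (hW : W + Wᵀ = 0) (hK : Kᵀ = K) : (W * K).trace = 0 := by
  have h : (W * K).trace = (Wᵀ * K).trace := by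
    rw [← Matrix.trace_transpose, Matrix.transpose_mul, hK, Matrix.trace_mul_comm]
  have h' : (W * K).trace + (Wᵀ * K).trace = 0 := by
    rw [← Matrix.trace_add, ← Matrix.add_mul, hW, Matrix.zero_mul, Matrix.trace_zero]
  linarith

/-- The trace form of the scalar inequality `2 (1 - 1 / h) ≤ h ^ 2 - 1` for `h > 0`. -/
theorem two_mul_trace_one_sub_inv_le {r : ℕ} {H : Matrix (Fin r) (Fin r) ℝ}
    (hH : H.PosSemidef) (hu : IsUnit H.det) :
    2 * (1 - H⁻¹).trace ≤ (H * H - 1).trace := by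
  have hS : (H - 1)ᴴ = H - 1 := by
    rw [Matrix.conjTranspose_sub, hH.isHermitian.eq, Matrix.conjTranspose_one]
  have h₁ : 0 ≤ ((H - 1) * (H - 1)).trace := by
    have := (Matrix.posSemidef_conjTranspose_mul_self (H - 1)).trace_nonneg
    rwa [hS] at this
  have h₂ : 0 ≤ ((H - 1) * H⁻¹ * (H - 1)).trace := by
    have := (hH.inv.conjTranspose_mul_mul_same (H - 1)).trace_nonneg
    rwa [hS] at this
  have e : (H - 1) * H⁻¹ * (H - 1) = H - 1 - 1 + H⁻¹ := by
    rw [Matrix.sub_mul, Matrix.mul_nonsing_inv H hu, Matrix.one_mul, Matrix.sub_mul,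
      Matrix.mul_sub, Matrix.mul_sub, Matrix.nonsing_inv_mul H hu]
    simp only [Matrix.one_mul, Matrix.mul_one]
    abel
  rw [e] at h₂
  simp only [Matrix.sub_mul, Matrix.mul_sub, Matrix.one_mul, Matrix.mul_one,
    Matrix.trace_sub, Matrix.trace_add] at h₁ h₂ ⊢
  linarith

/-- for the polar-decomposition retraction `Y(t) = (X + tE)·H(t)⁻¹`,
one has `‖Y(t) − X‖_F ≤ t·‖E‖_F` for all `t ≥ 0`. -/
theorem stmt_7 {d r : ℕ} (X E : Matrix (Fin d) (Fin r) ℝ)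
    (hX : Xᵀ * X = 1) (hE : Xᵀ * E + Eᵀ * X = 0) :
    ∀ t : ℝ, 0 ≤ t →
      ((1 + t ^ 2 • (Eᵀ * E)).PosDef ∧
        ∀ H : Matrix (Fin r) (Fin r) ℝ, H.PosSemidef →
          H * H = 1 + t ^ 2 • (Eᵀ * E) →
            frobNorm ((X + t • E) * H⁻¹ - X) ≤ t * frobNorm E) := by
  intro t ht
  have hP : (1 + t ^ 2 • (Eᵀ * E)).PosDef := by
    have := (Matrix.posSemidef_conjTranspose_mul_self E).smul (sq_nonneg t)
    rw [Matrix.conjTranspose_eq_transpose_of_trivial] at this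
    exact Matrix.PosDef.one.add_posSemidef this
  refine ⟨hP, fun H hH hHH => ?_⟩
  have hu : IsUnit H.det := by
    have h := hP.det_pos
    rw [← hHH, Matrix.det_mul] at h
    exact isUnit_iff_ne_zero.mpr fun h0 => by simp [h0] at h
  have hK : (H⁻¹)ᵀ = H⁻¹ := by
    simpa [Matrix.conjTranspose_eq_transpose_of_trivial] using hH.inv.isHermitian.eq
  have hA : (X + t • E)ᵀ * (X + t • E) = H * H := by
    have : (X + t • E)ᵀ * (X + t • E)
        = Xᵀ * X + t • (Xᵀ * E + Eᵀ * X) + t ^ 2 • (Eᵀ * E) := by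
      simp only [Matrix.transpose_add, Matrix.transpose_smul, Matrix.add_mul, Matrix.mul_add,
        Matrix.smul_mul, Matrix.mul_smul, smul_add, smul_smul, pow_two]
      abel
    rw [this, hX, hE, hHH, smul_zero, add_zero]
  set Y := (X + t • E) * H⁻¹ with hY
  have hYY : Yᵀ * Y = 1 := by
    rw [hY, Matrix.transpose_mul, hK, Matrix.mul_assoc, ← Matrix.mul_assoc _ _ H⁻¹, hA,
      Matrix.mul_assoc, Matrix.mul_nonsing_inv H hu, Matrix.mul_one,
      Matrix.nonsing_inv_mul H hu]
  have hXY : (Xᵀ * Y).trace = (H⁻¹).trace := by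
    have hskew : ((Xᵀ * E) * H⁻¹).trace = 0 :=
      trace_mul_eq_zero_of_skew_of_symm (by simpa [Matrix.transpose_mul] using hE) hK
    rw [hY, ← Matrix.mul_assoc, Matrix.mul_add, hX, Matrix.mul_smul, Matrix.add_mul,
      Matrix.one_mul, Matrix.smul_mul, Matrix.trace_add, Matrix.trace_smul, hskew,
      smul_zero, add_zero]
  have hYX : (Yᵀ * X).trace = (H⁻¹).trace := by
    rw [← hXY, ← Matrix.trace_transpose, Matrix.transpose_mul, Matrix.transpose_transpose]
  have hle := two_mul_trace_one_sub_inv_le hH hu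
  rw [hHH, add_sub_cancel_left, Matrix.trace_smul, smul_eq_mul, Matrix.trace_sub] at hle
  rw [frobNorm_eq_sqrt_trace, frobNorm_eq_sqrt_trace]
  nth_rewrite 1 [← Real.sqrt_sq ht]
  rw [← Real.sqrt_mul (sq_nonneg t)]
  refine Real.sqrt_le_sqrt ?_
  rw [Matrix.transpose_sub, Matrix.sub_mul, Matrix.mul_sub, Matrix.mul_sub, hYY, hX,
    Matrix.trace_sub, Matrix.trace_sub, Matrix.trace_sub, hXY, hYX]
  linarith
end
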